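/- arXiv:0911.3210 — 2 statements merged into one kernel-verified Lean document; each statement's English description precedes it below -/
import Mathlib

section
/- Every extreme point of S that lies in the open chamber { x ∈ ℝⁿ : x₁ > … > x_p and x_{p+1} > … > x_n } is of the form s(Λ_A^σ + Λ_B^τ), where Λ^σ denotes the diagonal matrix obtained from Λ by applying a permutation σ that permutes the first p diagonal entries among themselves and the last q diagonal entries among themselves, and σ, τ range over such block permutations. -/
open Matrix Polynomial

noncomputable section

/-- The signature matrix `J = diag(1,…,1,−1,…,−1)` with `p` ones and `q` minus ones. -/
def Jmat (p q : ℕ) : Matrix (Fin (p + q)) (Fin (p + q)) ℂ :=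
  Matrix.diagonal fun i => if (i : ℕ) < p then 1 else -1

/-- The group `SU(p,q)` of complex `(p+q)×(p+q)` matrices `g` with `det g = 1` and
`gᴴ J g = J`. -/
def SUpq (p q : ℕ) : Set (Matrix (Fin (p + q)) (Fin (p + q)) ℂ) :=
  { g | g.det = 1 ∧ g.conjTranspose * Jmat p q * g = Jmat p q }

/-- `x` is the ordered spectrum of `M`: the entries of `x` are non-increasing within the
first `p` coordinates and within the last `q` coordinates, every entry of the first block
is strictly greater than every entry of the second block, and the eigenvalues of `M`
counted with multiplicity are exactly the entries of `x` (its characteristic polynomial is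
`∏ i (X - x i)`). -/
def IsOrderedSpectrum (p q : ℕ) (M : Matrix (Fin (p + q)) (Fin (p + q)) ℂ)
    (x : Fin (p + q) → ℝ) : Prop :=
  (∀ i j : Fin (p + q), i ≤ j → ((j : ℕ) < p ∨ p ≤ (i : ℕ)) → x j ≤ x i) ∧
  (∀ i j : Fin (p + q), (i : ℕ) < p → p ≤ (j : ℕ) → x j < x i) ∧
  M.charpoly = ∏ i, (X - Polynomial.C ((x i : ℂ)))

section

open scoped Topology ComplexOrder

/-- If the increments of `f` lie in the range of its strict derivative `L` at `x₀`, then `f` attains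
every value close to `f x₀` in the affine subspace through `f x₀` directed by the range of `L`. -/
theorem HasStrictFDerivAt.eventually_exists_eq_add_smul {E G : Type*}
    [NormedAddCommGroup E] [NormedSpace ℝ E] [FiniteDimensional ℝ E]
    [NormedAddCommGroup G] [NormedSpace ℝ G] [FiniteDimensional ℝ G]
    {f : E → G} {L : E →L[ℝ] G} {x₀ : E} (hf : HasStrictFDerivAt f L x₀)
    (hrange : ∀ e, f e - f x₀ ∈ L.range) {d : G} (hd : d ∈ L.range) :
    ∀ᶠ s : ℝ in 𝓝 0, ∃ e, f e = f x₀ + s • d := by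
  have : CompleteSpace E := FiniteDimensional.complete ℝ E
  obtain ⟨P, hP⟩ := LinearMap.exists_leftInverse_of_injective L.range.subtype
    (Submodule.ker_subtype _)
  have hPv (v : L.range) : P (v : G) = v := LinearMap.congr_fun hP v
  have hg : HasStrictFDerivAt (fun e => LinearMap.toContinuousLinearMap P (f e - f x₀))
      ((LinearMap.toContinuousLinearMap P).comp L) x₀ :=
    (LinearMap.toContinuousLinearMap P).hasStrictFDerivAt.comp x₀ (hf.sub_const _)
  have hsurj : ((LinearMap.toContinuousLinearMap P).comp L).range = ⊤ := by
    rw [eq_top_iff]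
    rintro ⟨v, e, rfl⟩ -
    exact ⟨e, hPv ⟨L e, e, rfl⟩⟩
  have hmap := hg.map_nhds_eq_of_surj hsurj
  have hrg : Set.range (fun e => LinearMap.toContinuousLinearMap P (f e - f x₀)) ∈
      𝓝 (0 : L.range) := by
    have h0 : LinearMap.toContinuousLinearMap P (f x₀ - f x₀) = 0 := by simp
    rw [h0] at hmap
    rw [← hmap]
    exact Filter.range_mem_map
  have hcont : Filter.Tendsto (fun s : ℝ => s • (⟨d, hd⟩ : L.range)) (𝓝 0) (𝓝 0) := by
    have : Continuous fun s : ℝ => s • (⟨d, hd⟩ : L.range) := by fun_prop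
    simpa using this.tendsto 0
  filter_upwards [hcont hrg] with s hs
  obtain ⟨e, he⟩ := hs
  refine ⟨e, ?_⟩
  have h1 : P (f e - f x₀) = ⟨f e - f x₀, hrange e⟩ := hPv ⟨_, hrange e⟩
  have h2 : (⟨f e - f x₀, hrange e⟩ : L.range) = s • ⟨d, hd⟩ := h1.symm.trans he
  have h3 : f e - f x₀ = s • d := congrArg Subtype.val h2
  rw [← h3]; abel

/-- Solvability of `e^W (e^Z a e^{-Z} + b) e^{-W} = a + b + s d` with `Z, W ∈ E` for small `s`,
when `d` is in the range of the linearization. -/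
theorem eventually_exists_exp_conj_add_eq {𝔸 : Type*} [NormedRing 𝔸] [NormedAlgebra ℝ 𝔸]
    [FiniteDimensional ℝ 𝔸] (E : Submodule ℝ 𝔸) (a b : 𝔸)
    (hE : ∀ Z ∈ E, ∀ W ∈ E, ∃ Z' ∈ E, ∃ W' ∈ E,
      NormedSpace.exp W * (NormedSpace.exp Z * a * NormedSpace.exp (-Z) + b) *
        NormedSpace.exp (-W) - (a + b) =
        (Z' * a - a * Z') + (W' * (a + b) - (a + b) * W'))
    {Z₀ W₀ : 𝔸} (hZ₀ : Z₀ ∈ E) (hW₀ : W₀ ∈ E) :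
    ∀ᶠ s : ℝ in 𝓝 0, ∃ Z ∈ E, ∃ W ∈ E,
      NormedSpace.exp W * (NormedSpace.exp Z * a * NormedSpace.exp (-Z) + b) *
        NormedSpace.exp (-W) =
        (a + b) + s • ((Z₀ * a - a * Z₀) + (W₀ * (a + b) - (a + b) * W₀)) := by
  have : CompleteSpace 𝔸 := FiniteDimensional.complete ℝ 𝔸
  let z : E × E →L[ℝ] 𝔸 := E.subtypeL.comp (ContinuousLinearMap.fst ℝ E E)
  let w : E × E →L[ℝ] 𝔸 := E.subtypeL.comp (ContinuousLinearMap.snd ℝ E E)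
  have hexp (u : E × E →L[ℝ] 𝔸) :
      HasStrictFDerivAt (fun x => NormedSpace.exp (u x)) u (0 : E × E) := by
    have h0 : HasStrictFDerivAt (NormedSpace.exp : 𝔸 → 𝔸) (1 : 𝔸 →L[ℝ] 𝔸) (u 0) := by
      rw [map_zero]; exact hasStrictFDerivAt_exp_zero
    exact h0.comp (0 : E × E) u.hasStrictFDerivAt
  let f : E × E → 𝔸 := fun x => NormedSpace.exp (w x) *
    (NormedSpace.exp (z x) * a * NormedSpace.exp ((-z) x) + b) * NormedSpace.exp ((-w) x)
  have hf0 : f 0 = a + b := by simp [f]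
  obtain ⟨L, hf, hLapp⟩ : ∃ L : E × E →L[ℝ] 𝔸, HasStrictFDerivAt f L 0 ∧ ∀ x, L x =
      ((x.1 : 𝔸) * a - a * x.1) + ((x.2 : 𝔸) * (a + b) - (a + b) * x.2) := by
    refine ⟨_, ((hexp w).mul' ((((hexp z).mul_const' a).mul' (hexp (-z))).add_const b)).mul'
      (hexp (-w)), fun x => ?_⟩
    simp [z, w]
    noncomm_ring
  have hmem : ∀ e, f e - f 0 ∈ L.range := by
    rintro ⟨Z, W⟩
    obtain ⟨Z', hZ', W', hW', h⟩ := hE Z Z.2 W W.2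
    refine ⟨(⟨Z', hZ'⟩, ⟨W', hW'⟩), ?_⟩
    rw [hf0]
    exact (hLapp _).trans h.symm
  have hev := hf.eventually_exists_eq_add_smul hmem
    (d := (Z₀ * a - a * Z₀) + (W₀ * (a + b) - (a + b) * W₀))
    ⟨(⟨Z₀, hZ₀⟩, ⟨W₀, hW₀⟩), hLapp _⟩
  filter_upwards [hev] with s hs
  obtain ⟨⟨Z, W⟩, he⟩ := hs
  rw [hf0] at he
  exact ⟨Z, Z.2, W, W.2, he⟩

variable {ι : Type*} [DecidableEq ι]

/-- The real diagonal matrix with entries `θ`, viewed as a complex matrix. -/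
def realDiagonal (θ : ι → ℝ) : Matrix ι ι ℂ := diagonal fun i => (θ i : ℂ)

theorem realDiagonal_conjTranspose (θ : ι → ℝ) : (realDiagonal θ)ᴴ = realDiagonal θ := by
  rw [realDiagonal, diagonal_conjTranspose]
  congr 1
  ext i
  simp

variable [Fintype ι]

theorem realDiagonal_commute (θ φ : ι → ℝ) : Commute (realDiagonal θ) (realDiagonal φ) := by
  simp only [Commute, SemiconjBy, realDiagonal, diagonal_mul_diagonal, mul_comm]

theorem realDiagonal_mul_self {s : ι → ℝ} (hs : ∀ i, s i = 1 ∨ s i = -1) :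
    realDiagonal s * realDiagonal s = 1 := by
  rw [realDiagonal, diagonal_mul_diagonal, ← diagonal_one]
  congr 1
  ext i
  rcases hs i with h | h <;> simp [h]

theorem commute_realDiagonal_iff {θ : ι → ℝ} {M : Matrix ι ι ℂ} :
    Commute (realDiagonal θ) M ↔ ∀ i j, (θ i : ℂ) * M i j = M i j * θ j := by
  rw [Commute, SemiconjBy, ← Matrix.ext_iff]
  simp only [realDiagonal, diagonal_mul, mul_diagonal]

/-- The matrices that are skew-adjoint for the form `realDiagonal s` and commute with every real
diagonal matrix commuting with `A`. -/
def skewCommutant (s : ι → ℝ) (A : Matrix ι ι ℂ) : Submodule ℝ (Matrix ι ι ℂ) where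
  carrier := {Z | Zᴴ = -(realDiagonal s * Z * realDiagonal s) ∧
    ∀ θ, Commute (realDiagonal θ) A → Commute (realDiagonal θ) Z}
  add_mem' := by
    rintro Y Z ⟨hY, hY'⟩ ⟨hZ, hZ'⟩
    refine ⟨?_, fun θ hθ => (hY' θ hθ).add_right (hZ' θ hθ)⟩
    rw [conjTranspose_add, hY, hZ]
    noncomm_ring
  zero_mem' := by simp
  smul_mem' := by
    rintro c Z ⟨hZ, hZ'⟩
    refine ⟨?_, fun θ hθ => (hZ' θ hθ).smul_right c⟩
    rw [conjTranspose_smul, hZ]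
    simp

theorem bracket_conjTranspose {J Z A : Matrix ι ι ℂ} (hJ : J * J = 1)
    (hZ : Zᴴ = -(J * Z * J)) (hA : Aᴴ = J * A * J) :
    (Z * A - A * Z)ᴴ = J * (Z * A - A * Z) * J := by
  rw [conjTranspose_sub, conjTranspose_mul, conjTranspose_mul, hZ, hA]
  have h1 : J * A * J * -(J * Z * J) = -(J * A * (J * J) * Z * J) := by noncomm_ring
  have h2 : -(J * Z * J) * (J * A * J) = -(J * Z * (J * J) * A * J) := by noncomm_ring
  rw [h1, h2, hJ]
  noncomm_ring

theorem apply_self_im_eq_zero {s : ι → ℝ} (hs : ∀ i, s i = 1 ∨ s i = -1) {T : Matrix ι ι ℂ}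
    (hT : Tᴴ = realDiagonal s * T * realDiagonal s) (i : ι) : ((T i i).re : ℂ) = T i i := by
  have h : star (T i i) = (s i : ℂ) * T i i * s i := by
    have := congrFun (congrFun hT i) i
    simpa [realDiagonal, conjTranspose_apply] using this
  rw [← Complex.conj_eq_iff_re]
  rcases hs i with h' | h' <;> simpa [h'] using h

theorem apply_conj_eq {s : ι → ℝ} {T : Matrix ι ι ℂ}
    (hT : Tᴴ = realDiagonal s * T * realDiagonal s) (i j : ι) :
    star (T j i) = (s i : ℂ) * T i j * s j := by
  have := congrFun (congrFun hT i) j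
  simpa [realDiagonal, conjTranspose_apply] using this

/-- Any real diagonal orthogonal to the diagonal commutant of `A` is the diagonal of a commutator
`[Z, A]` with `Z` in `skewCommutant s A`. -/
theorem exists_skewCommutant_diag_eq {s : ι → ℝ} (hs : ∀ i, s i = 1 ∨ s i = -1)
    {A : Matrix ι ι ℂ} (hA : Aᴴ = realDiagonal s * A * realDiagonal s) (D : ι → ℝ)
    (hD : ∀ θ : ι → ℝ, Commute (realDiagonal θ) A → ∑ i, θ i * D i = 0) :
    ∃ Z ∈ skewCommutant s A, ∀ i, (Z * A - A * Z) i i = D i := by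
  have hJ := realDiagonal_mul_self hs
  let φ : Matrix ι ι ℂ →ₗ[ℝ] (ι → ℝ) :=
    { toFun := fun Z i => ((Z * A - A * Z) i i).re
      map_add' := fun Y Z => by
        ext i
        simp only [add_mul, mul_add, Pi.add_apply, ← Complex.add_re]
        congr 1
        simp only [Matrix.sub_apply, Matrix.add_apply]
        ring
      map_smul' := fun c Z => by
        ext i
        simp [Matrix.smul_apply, mul_sub] }
  suffices h : D ∈ (skewCommutant s A).map φ by
    obtain ⟨Z, hZ, hZD⟩ := h
    refine ⟨Z, hZ, fun i => ?_⟩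
    rw [← hZD, ← apply_self_im_eq_zero hs (bracket_conjTranspose hJ hZ.1 hA) i]
    rfl
  by_contra hDn
  obtain ⟨f, hfD, hf⟩ := Submodule.exists_le_ker_of_notMem hDn
  let θ : ι → ℝ := fun i => f (Pi.single i 1)
  have hfθ (v : ι → ℝ) : f v = ∑ i, θ i * v i := by
    conv_lhs => rw [pi_eq_sum_univ' v]
    simp [θ, mul_comm]
  let Y := realDiagonal θ * A - A * realDiagonal θ
  have hY : Yᴴ = -(realDiagonal s * Y * realDiagonal s) := by
    simp only [Y, conjTranspose_sub, conjTranspose_mul, realDiagonal_conjTranspose, hA]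
    have hc := (realDiagonal_commute s θ).eq
    have h1 : realDiagonal s * A * realDiagonal s * realDiagonal θ =
        realDiagonal s * (A * realDiagonal θ) * realDiagonal s := by
      simp only [mul_assoc, hc]
    have h2 : realDiagonal θ * (realDiagonal s * A * realDiagonal s) =
        realDiagonal s * (realDiagonal θ * A) * realDiagonal s := by
      simp only [← mul_assoc, hc]
    rw [h1, h2]
    noncomm_ring
  have hYmem : Yᴴ ∈ skewCommutant s A := by
    refine ⟨?_, fun ψ hψ => ?_⟩
    · rw [conjTranspose_conjTranspose, hY]
      have : realDiagonal s * -(realDiagonal s * Y * realDiagonal s) * realDiagonal s =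
        -((realDiagonal s * realDiagonal s) * Y * (realDiagonal s * realDiagonal s)) := by
        noncomm_ring
      rw [this, hJ]
      simp
    · have h1 : Commute (realDiagonal ψ) Y :=
        ((realDiagonal_commute ψ θ).mul_right hψ).sub_right
          (hψ.mul_right (realDiagonal_commute ψ θ))
      have h2 := congrArg conjTranspose h1.eq
      rw [conjTranspose_mul, conjTranspose_mul, realDiagonal_conjTranspose] at h2
      exact h2.symm
  have h0 : f (φ Yᴴ) = 0 := hf ⟨_, hYmem, rfl⟩
  have htr : trace (Yᴴ * Y) = 0 := by
    have h1 : trace (Yᴴ * Y) = -trace (realDiagonal θ * (Yᴴ * A - A * Yᴴ)) := by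
      simp only [Y, mul_sub, trace_sub]
      rw [trace_mul_comm Yᴴ (realDiagonal θ * A), ← mul_assoc Yᴴ A,
        trace_mul_comm (Yᴴ * A) (realDiagonal θ), mul_assoc (realDiagonal θ) A]
      ring
    rw [h1, neg_eq_zero, trace]
    rw [hfθ] at h0
    have h2 : ∀ i, (realDiagonal θ * (Yᴴ * A - A * Yᴴ)).diag i = ((θ i * φ Yᴴ i : ℝ) : ℂ) := by
      intro i
      rw [diag_apply, realDiagonal, diagonal_mul, Complex.ofReal_mul]
      congr 1
      exact (apply_self_im_eq_zero hs (bracket_conjTranspose hJ hYmem.1 hA) i).symm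
    rw [Finset.sum_congr rfl fun i _ => h2 i, ← Complex.ofReal_sum, h0, Complex.ofReal_zero]
  have hY0 : Y = 0 := trace_conjTranspose_mul_self_eq_zero_iff.1 htr
  exact hfD ((hfθ D).trans (hD θ (sub_eq_zero.1 hY0)))

/-- Surjectivity of the linearization `(Z, W) ↦ [Z, A] + [W, diag x]`. -/
theorem exists_skewCommutant_bracket_add_eq {s : ι → ℝ} (hs : ∀ i, s i = 1 ∨ s i = -1)
    {A : Matrix ι ι ℂ} (hA : Aᴴ = realDiagonal s * A * realDiagonal s)
    {x : ι → ℝ} (hx : Function.Injective x) {T : Matrix ι ι ℂ}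
    (hT : Tᴴ = realDiagonal s * T * realDiagonal s)
    (hTc : ∀ θ : ι → ℝ, Commute (realDiagonal θ) A → Commute (realDiagonal θ) T)
    (hTt : ∀ θ : ι → ℝ, Commute (realDiagonal θ) A → trace (realDiagonal θ * T) = 0) :
    ∃ Z ∈ skewCommutant s A, ∃ W ∈ skewCommutant s A,
      T = (Z * A - A * Z) + (W * realDiagonal x - realDiagonal x * W) := by
  have hJ := realDiagonal_mul_self hs
  obtain ⟨Z, hZ, hZd⟩ := exists_skewCommutant_diag_eq hs hA (fun i => (T i i).re) fun θ hθ => by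
    have h := hTt θ hθ
    simp only [trace, diag_apply, realDiagonal, diagonal_mul] at h
    rw [Finset.sum_congr rfl fun i _ => by rw [← apply_self_im_eq_zero hs hT i]] at h
    exact_mod_cast h
  set R := T - (Z * A - A * Z) with hR
  have hRd (i : ι) : R i i = 0 := by
    rw [hR, Matrix.sub_apply, hZd, apply_self_im_eq_zero hs hT, sub_self]
  have hRh : Rᴴ = realDiagonal s * R * realDiagonal s := by
    rw [hR, conjTranspose_sub, hT, bracket_conjTranspose hJ hZ.1 hA]
    noncomm_ring
  refine ⟨Z, hZ, of fun i j => R i j / ((x j : ℂ) - x i), ⟨?_, fun θ hθ => ?_⟩, ?_⟩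
  · ext i j
    have h := apply_conj_eq hRh i j
    simp only [conjTranspose_apply, of_apply, star_div₀, h, realDiagonal, Matrix.neg_apply,
      mul_diagonal, diagonal_mul]
    have : star ((x i : ℂ) - x j) = -((x j : ℂ) - x i) := by simp
    rw [this, div_neg]
    ring
  · have hRc : Commute (realDiagonal θ) R := (hTc θ hθ).sub_right
      (((hZ.2 θ hθ).mul_right hθ).sub_right (hθ.mul_right (hZ.2 θ hθ)))
    rw [commute_realDiagonal_iff] at hRc ⊢
    intro i j
    simp only [of_apply, ← mul_div_assoc, hRc i j]
    ring
  · rw [← sub_eq_iff_eq_add', ← hR]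
    ext i j
    simp only [Matrix.sub_apply, realDiagonal, mul_diagonal, diagonal_mul, of_apply]
    by_cases hij : i = j
    · subst hij; simp [hRd]
    · have : (x j : ℂ) - x i ≠ 0 :=
        sub_ne_zero.2 fun h => hij (hx (Complex.ofReal_injective h)).symm
      field_simp

theorem exp_conjTranspose_of_skew {J Z : Matrix ι ι ℂ} (hJ : J * J = 1)
    (hZ : Zᴴ = -(J * Z * J)) :
    (NormedSpace.exp Z)ᴴ = J * NormedSpace.exp (-Z) * J := by
  have hJinv : J⁻¹ = J := inv_eq_left_inv hJ
  have hJu : IsUnit J := IsUnit.of_mul_eq_one _ hJ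
  have h := Matrix.exp_conj J (-Z) hJu
  rw [hJinv] at h
  rw [← Matrix.exp_conjTranspose, hZ, ← h]
  congr 1
  noncomm_ring

theorem exp_mul_exp_neg (Z : Matrix ι ι ℂ) :
    NormedSpace.exp Z * NormedSpace.exp (-Z) = 1 := by
  rw [← Matrix.exp_add_of_commute _ _ (Commute.refl Z).neg_right, add_neg_cancel,
    NormedSpace.exp_zero]

theorem conj_conjTranspose {J u u' A : Matrix ι ι ℂ} (hJ : J * J = 1)
    (hu : uᴴ = J * u' * J) (hu' : u'ᴴ = J * u * J) (hA : Aᴴ = J * A * J) :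
    (u * A * u')ᴴ = J * (u * A * u') * J := by
  rw [conjTranspose_mul, conjTranspose_mul, hu, hu', hA]
  have : J * u * J * (J * A * J * (J * u' * J)) = J * u * (J * J) * A * (J * J) * u' * J := by
    noncomm_ring
  rw [this, hJ]
  noncomm_ring

theorem trace_mul_conj {θ u u' A : Matrix ι ι ℂ} (hu : u' * u = 1) (hc : Commute θ u) :
    trace (θ * (u * A * u')) = trace (θ * A) := by
  have : θ * (u * A * u') = u * (θ * A * u') := by
    rw [← mul_assoc, ← mul_assoc, hc.eq]
    noncomm_ring
  rw [this, trace_mul_comm, mul_assoc, hu, mul_one]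

/-- If `A + B` is diagonal with distinct real entries `x`, then every small
perturbation of `x` along `D`, for `D` orthogonal to the diagonal commutant of `A`, is the diagonal
form of a sum of pseudo-unitary conjugates of `A` and `B`. -/
theorem eventually_exists_conj_add_conj_eq {s : ι → ℝ} (hs : ∀ i, s i = 1 ∨ s i = -1)
    {A B : Matrix ι ι ℂ} (hA : Aᴴ = realDiagonal s * A * realDiagonal s)
    (hB : Bᴴ = realDiagonal s * B * realDiagonal s)
    {x : ι → ℝ} (hx : Function.Injective x) (hAB : A + B = realDiagonal x) {D : ι → ℝ}
    (hD : ∀ θ : ι → ℝ, Commute (realDiagonal θ) A → ∑ i, θ i * D i = 0) :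
    ∀ᶠ t : ℝ in 𝓝 0, ∃ g h : Matrix ι ι ℂ,
      gᴴ * realDiagonal s * g = realDiagonal s ∧ hᴴ * realDiagonal s * h = realDiagonal s ∧
      g * A * g⁻¹ + h * B * h⁻¹ = realDiagonal (x + t • D) := by
  have hJ := realDiagonal_mul_self hs
  set J := realDiagonal s with hJdef
  have hDh : (realDiagonal D)ᴴ = J * realDiagonal D * J := by
    rw [realDiagonal_conjTranspose, (realDiagonal_commute s D).eq, mul_assoc, hJ, mul_one]
  have hBc (θ : ι → ℝ) (hθ : Commute (realDiagonal θ) A) : Commute (realDiagonal θ) B := by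
    rw [eq_sub_of_add_eq' hAB]
    exact (realDiagonal_commute θ x).sub_right hθ
  have htrD (θ : ι → ℝ) (hθ : Commute (realDiagonal θ) A) :
      trace (realDiagonal θ * realDiagonal D) = 0 := by
    rw [realDiagonal, realDiagonal, diagonal_mul_diagonal, trace_diagonal]
    exact_mod_cast hD θ hθ
  obtain ⟨Z₀, hZ₀, W₀, hW₀, h₀⟩ := exists_skewCommutant_bracket_add_eq hs hA hx hDh
    (fun θ _ => realDiagonal_commute θ D) htrD
  have hskew {Z : Matrix ι ι ℂ} (hZ : Z ∈ skewCommutant s A) :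
      (NormedSpace.exp Z)ᴴ = J * NormedSpace.exp (-Z) * J ∧
      (NormedSpace.exp (-Z))ᴴ = J * NormedSpace.exp Z * J ∧
      NormedSpace.exp (-Z) * NormedSpace.exp Z = 1 ∧
      ∀ θ, Commute (realDiagonal θ) A → Commute (realDiagonal θ) (NormedSpace.exp Z) ∧
        Commute (realDiagonal θ) (NormedSpace.exp (-Z)) := by
    refine ⟨exp_conjTranspose_of_skew hJ hZ.1, ?_, ?_, fun θ hθ => ⟨?_, ?_⟩⟩
    · simpa using exp_conjTranspose_of_skew hJ ((skewCommutant s A).neg_mem hZ).1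
    · simpa using exp_mul_exp_neg (-Z)
    · exact (hZ.2 θ hθ).exp_right
    · exact (((skewCommutant s A).neg_mem hZ).2 θ hθ).exp_right
  have hE : ∀ Z ∈ skewCommutant s A, ∀ W ∈ skewCommutant s A,
      ∃ Z' ∈ skewCommutant s A, ∃ W' ∈ skewCommutant s A,
      NormedSpace.exp W * (NormedSpace.exp Z * A * NormedSpace.exp (-Z) + B) *
        NormedSpace.exp (-W) - (A + B) =
        (Z' * A - A * Z') + (W' * (A + B) - (A + B) * W') := by
    intro Z hZ W hW
    obtain ⟨hZ1, hZ2, hZ3, hZ4⟩ := hskew hZ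
    obtain ⟨hW1, hW2, hW3, hW4⟩ := hskew hW
    have hc (θ : ι → ℝ) (hθ : Commute (realDiagonal θ) A) : Commute (realDiagonal θ)
        (NormedSpace.exp Z * A * NormedSpace.exp (-Z) + B) :=
      (((hZ4 θ hθ).1.mul_right hθ).mul_right (hZ4 θ hθ).2).add_right (hBc θ hθ)
    have hh : (NormedSpace.exp Z * A * NormedSpace.exp (-Z) + B)ᴴ =
        J * (NormedSpace.exp Z * A * NormedSpace.exp (-Z) + B) * J := by
      rw [conjTranspose_add, conj_conjTranspose hJ hZ1 hZ2 hA, hB]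
      noncomm_ring
    rw [hAB]
    refine exists_skewCommutant_bracket_add_eq hs hA hx ?_ ?_ ?_
    · rw [conjTranspose_sub, conj_conjTranspose hJ hW1 hW2 hh, ← hAB, conjTranspose_add, hA, hB]
      noncomm_ring
    · exact fun θ hθ => (((hW4 θ hθ).1.mul_right (hc θ hθ)).mul_right (hW4 θ hθ).2).sub_right
        (realDiagonal_commute θ x)
    · intro θ hθ
      rw [mul_sub, trace_sub, trace_mul_conj hW3 (hW4 θ hθ).1, mul_add, trace_add,
        trace_mul_conj hZ3 (hZ4 θ hθ).1, ← hAB, mul_add, trace_add, sub_self]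
  have hev : ∀ᶠ t : ℝ in 𝓝 0, ∃ Z ∈ skewCommutant s A, ∃ W ∈ skewCommutant s A,
      NormedSpace.exp W * (NormedSpace.exp Z * A * NormedSpace.exp (-Z) + B) *
        NormedSpace.exp (-W) =
        (A + B) + t • ((Z₀ * A - A * Z₀) + (W₀ * (A + B) - (A + B) * W₀)) := by
    let : NormedRing (Matrix ι ι ℂ) := Matrix.linftyOpNormedRing
    let : NormedAlgebra ℝ (Matrix ι ι ℂ) := Matrix.linftyOpNormedAlgebra
    exact eventually_exists_exp_conj_add_eq (skewCommutant s A) A B hE hZ₀ hW₀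
  filter_upwards [hev] with t ht
  obtain ⟨Z, hZ, W, hW, h⟩ := ht
  obtain ⟨hZ1, hZ2, hZ3, hZ4⟩ := hskew hZ
  obtain ⟨hW1, hW2, hW3, hW4⟩ := hskew hW
  have hU {u u' : Matrix ι ι ℂ} (hu : uᴴ = J * u' * J) (huu : u' * u = 1) :
      uᴴ * J * u = J := by
    rw [hu, mul_assoc _ J J, hJ, mul_one, mul_assoc, huu, mul_one]
  rw [hAB, ← h₀] at h
  have hZi : (NormedSpace.exp Z)⁻¹ = NormedSpace.exp (-Z) := inv_eq_left_inv hZ3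
  have hWi : (NormedSpace.exp W)⁻¹ = NormedSpace.exp (-W) := inv_eq_left_inv hW3
  refine ⟨NormedSpace.exp W * NormedSpace.exp Z, NormedSpace.exp W, ?_, ?_, ?_⟩
  · rw [conjTranspose_mul]
    have := hU hZ1 hZ3
    calc (NormedSpace.exp Z)ᴴ * (NormedSpace.exp W)ᴴ * J * (NormedSpace.exp W * NormedSpace.exp Z)
        = (NormedSpace.exp Z)ᴴ * ((NormedSpace.exp W)ᴴ * J * NormedSpace.exp W) *
          NormedSpace.exp Z := by noncomm_ring
      _ = J := by rw [hU hW1 hW3, this]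
  · exact hU hW1 hW3
  · rw [Matrix.mul_inv_rev, hZi, hWi]
    have hx' : realDiagonal (x + t • D) = realDiagonal x + t • realDiagonal D := by
      ext i j
      by_cases hij : i = j
      · subst hij; simp [realDiagonal]
      · simp [realDiagonal, hij]
    rw [hx', ← h]
    noncomm_ring

theorem pseudoUnitary_inv_eq {J g : Matrix ι ι ℂ} (hJ : J * J = 1) (hg : gᴴ * J * g = J) :
    J * gᴴ * J * g = 1 ∧ g⁻¹ = J * gᴴ * J := by
  have h : J * gᴴ * J * g = 1 := by
    rw [mul_assoc J, mul_assoc J, hg, hJ]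
  exact ⟨h, inv_eq_left_inv h⟩

theorem pseudoUnitary_mul {κ : Type*} [Fintype κ] {J g h : Matrix κ κ ℂ}
    (hg : gᴴ * J * g = J) (hh : hᴴ * J * h = J) :
    (g * h)ᴴ * J * (g * h) = J := by
  rw [conjTranspose_mul]
  calc hᴴ * gᴴ * J * (g * h) = hᴴ * (gᴴ * J * g) * h := by noncomm_ring
    _ = J := by rw [hg, hh]

theorem pseudoUnitary_inv {J g : Matrix ι ι ℂ} (hJ : J * J = 1) (hg : gᴴ * J * g = J) :
    (g⁻¹)ᴴ * J * g⁻¹ = J := by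
  obtain ⟨h, hi⟩ := pseudoUnitary_inv_eq hJ hg
  have h1 : g * g⁻¹ = 1 := by rw [hi]; exact mul_eq_one_comm.1 h
  have h2 : (g⁻¹)ᴴ * gᴴ = 1 := by rw [← conjTranspose_mul, h1, conjTranspose_one]
  nth_rewrite 1 [← hg]
  calc (g⁻¹)ᴴ * (gᴴ * J * g) * g⁻¹ = ((g⁻¹)ᴴ * gᴴ) * J * (g * g⁻¹) := by noncomm_ring
    _ = J := by rw [h1, h2, one_mul, mul_one]

theorem pseudoUnitary_mul_inv {J g : Matrix ι ι ℂ} (hJ : J * J = 1) (hg : gᴴ * J * g = J) :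
    g⁻¹ * g = 1 ∧ g * g⁻¹ = 1 := by
  obtain ⟨h, hi⟩ := pseudoUnitary_inv_eq hJ hg
  rw [hi]
  exact ⟨h, mul_eq_one_comm.1 h⟩

theorem conj_realDiagonal_conjTranspose {s : ι → ℝ} (hs : ∀ i, s i = 1 ∨ s i = -1)
    {g : Matrix ι ι ℂ} (hg : gᴴ * realDiagonal s * g = realDiagonal s) (a : ι → ℝ) :
    (g * realDiagonal a * g⁻¹)ᴴ =
      realDiagonal s * (g * realDiagonal a * g⁻¹) * realDiagonal s := by
  have hJ := realDiagonal_mul_self hs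
  obtain ⟨-, hi⟩ := pseudoUnitary_inv_eq hJ hg
  refine conj_conjTranspose hJ ?_ ?_ ?_
  · rw [hi]
    calc gᴴ = 1 * gᴴ * 1 := by simp
      _ = _ := by rw [← hJ]; noncomm_ring
  · rw [hi, conjTranspose_mul, conjTranspose_mul, conjTranspose_conjTranspose,
      realDiagonal_conjTranspose, mul_assoc]
  · rw [realDiagonal_conjTranspose, (realDiagonal_commute s a).eq, mul_assoc, hJ, mul_one]

theorem posDef_conj_realDiagonal {s : ι → ℝ} (hs : ∀ i, s i = 1 ∨ s i = -1)
    {g : Matrix ι ι ℂ} (hg : gᴴ * realDiagonal s * g = realDiagonal s) {a : ι → ℝ} {c : ℝ}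
    (hc : ∀ i, 0 < s i * (a i - c)) :
    (realDiagonal s * (g * realDiagonal a * g⁻¹) - (c : ℂ) • realDiagonal s).PosDef := by
  have hJ := realDiagonal_mul_self hs
  obtain ⟨hi1, hi2⟩ := pseudoUnitary_mul_inv hJ hg
  have hg' := pseudoUnitary_inv hJ hg
  have hJg : realDiagonal s * g = (g⁻¹)ᴴ * realDiagonal s := by
    nth_rewrite 1 [← hg']
    rw [mul_assoc, hi1, mul_one]
  have hd : (realDiagonal fun i => s i * (a i - c)) =
      realDiagonal s * realDiagonal a - (c : ℂ) • realDiagonal s := by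
    ext i j
    by_cases hij : i = j
    · subst hij
      simp [realDiagonal]
      ring
    · simp [realDiagonal, hij]
  have hp : (realDiagonal fun i => s i * (a i - c)).PosDef :=
    posDef_diagonal_iff.2 fun i => by exact_mod_cast hc i
  have := hp.conjTranspose_mul_mul_same (B := g⁻¹)
    (mulVec_injective_of_isUnit (IsUnit.of_mul_eq_one _ hi1))
  rw [hd, mul_sub, sub_mul, mul_smul_comm, smul_mul_assoc, hg', ← mul_assoc, ← hJg] at this
  convert this using 2
  noncomm_ring

theorem star_dotProduct_realDiagonal_mulVec (d : ι → ℝ) (w : ι → ℂ) :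
    star w ⬝ᵥ (realDiagonal d *ᵥ w) = ((∑ i, d i * ‖w i‖ ^ 2 : ℝ) : ℂ) := by
  rw [dotProduct, Complex.ofReal_sum]
  refine Finset.sum_congr rfl fun i _ => ?_
  rw [realDiagonal, mulVec_diagonal, Pi.star_apply, Complex.ofReal_mul, Complex.ofReal_pow,
    ← Complex.conj_mul']
  simp only [Complex.star_def]
  ring

/-- One half of Sylvester's law of inertia, for diagonal Hermitian forms. -/
theorem card_pos_le_of_congruence {V : Matrix ι ι ℂ} {s d : ι → ℝ}
    (h : Vᴴ * realDiagonal s * V = realDiagonal d) :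
    Fintype.card {i // 0 < d i} ≤ Fintype.card {i // 0 < s i} := by
  by_contra hlt
  push Not at hlt
  let ext : ({i // 0 < d i} → ℂ) →ₗ[ℂ] (ι → ℂ) :=
    { toFun := fun w i => if hi : 0 < d i then w ⟨i, hi⟩ else 0
      map_add' := fun u w => by
        ext i
        by_cases hi : 0 < d i <;> simp [hi]
      map_smul' := fun c w => by
        ext i
        by_cases hi : 0 < d i <;> simp [hi] }
  let f : ({i // 0 < d i} → ℂ) →ₗ[ℂ] ({i // 0 < s i} → ℂ) :=
    (LinearMap.funLeft ℂ ℂ Subtype.val).comp ((mulVecLin V).comp ext)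
  have hker : LinearMap.ker f ≠ ⊥ := LinearMap.ker_ne_bot_of_finrank_lt (by simpa using hlt)
  obtain ⟨w, hw, hw0⟩ := (Submodule.ne_bot_iff _).1 hker
  have hVw (i : ι) (hi : 0 < s i) : (V *ᵥ ext w) i = 0 := congrFun hw ⟨i, hi⟩
  have h1 : star (ext w) ⬝ᵥ (realDiagonal d *ᵥ ext w) =
      star (V *ᵥ ext w) ⬝ᵥ (realDiagonal s *ᵥ (V *ᵥ ext w)) := by
    rw [← h, star_mulVec, ← dotProduct_mulVec, mulVec_mulVec, mulVec_mulVec, mul_assoc]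
  rw [star_dotProduct_realDiagonal_mulVec, star_dotProduct_realDiagonal_mulVec] at h1
  have h2 := Complex.ofReal_injective h1
  have h3 : ∑ i, s i * ‖(V *ᵥ ext w) i‖ ^ 2 ≤ 0 := Finset.sum_nonpos fun i _ => by
    by_cases hi : 0 < s i
    · simp [hVw i hi]
    · exact mul_nonpos_of_nonpos_of_nonneg (not_lt.1 hi) (by positivity)
  have hext (i : ι) (hi : 0 < d i) : ext w i = w ⟨i, hi⟩ := dif_pos hi
  have hext' (i : ι) (hi : ¬ 0 < d i) : ext w i = 0 := dif_neg hi
  have h4 : 0 < ∑ i, d i * ‖ext w i‖ ^ 2 := by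
    obtain ⟨⟨k, hk⟩, hwk⟩ := Function.ne_iff.1 hw0
    refine Finset.sum_pos' (fun i _ => ?_) ⟨k, Finset.mem_univ _, ?_⟩
    · by_cases hi : 0 < d i
      · positivity
      · simp [hext' i hi]
    · have : ext w k ≠ 0 := by rw [hext k hk]; exact hwk
      positivity
  linarith

/-- A self-adjoint matrix for the form `realDiagonal s` with distinct real eigenvalues, correctly
ordered, is diagonalized by a pseudo-unitary matrix as soon as some real shift is definite. -/
theorem exists_pseudoUnitary_diagonalization {s : ι → ℝ} (hs : ∀ i, s i = 1 ∨ s i = -1)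
    {M : Matrix ι ι ℂ} (hM : Mᴴ = realDiagonal s * M * realDiagonal s) {c : ℝ}
    (hpos : (realDiagonal s * M - (c : ℂ) • realDiagonal s).PosDef) {x : ι → ℝ}
    (hx : Function.Injective x) (hord : ∀ i j, s i = 1 → s j = -1 → x j < x i)
    (hchar : M.charpoly = ∏ i, (X - C (x i : ℂ))) :
    ∃ V : Matrix ι ι ℂ, Vᴴ * realDiagonal s * V = realDiagonal s ∧
      M * V = V * realDiagonal x := by
  have hJ := realDiagonal_mul_self hs
  have hev (i : ι) : ∃ v ≠ 0, M *ᵥ v = (x i : ℂ) • v := by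
    have h : (Matrix.scalar ι (x i : ℂ) - M).det = 0 := by
      rw [← eval_charpoly, hchar, eval_prod]
      exact Finset.prod_eq_zero (Finset.mem_univ i) (by simp)
    obtain ⟨v, hv0, hv⟩ := exists_mulVec_eq_zero_iff.2 h
    refine ⟨v, hv0, ?_⟩
    rw [sub_mulVec, sub_eq_zero] at hv
    rw [← hv]
    ext k
    simp [Matrix.scalar_apply, mulVec_diagonal]
  choose v hv0 hv using hev
  let W : Matrix ι ι ℂ := of fun k i => v i k
  have hW : M * W = W * realDiagonal x := by
    ext k i
    have := congrFun (hv i) k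
    rw [realDiagonal, mul_diagonal]
    simpa [W, mul_apply, mulVec, dotProduct, mul_comm] using this
  set G := Wᴴ * realDiagonal s * W with hG
  have hGh : Gᴴ = G := by
    rw [hG, conjTranspose_mul, conjTranspose_mul, conjTranspose_conjTranspose,
      realDiagonal_conjTranspose, mul_assoc]
  have hJM : realDiagonal s * M = Mᴴ * realDiagonal s := by
    rw [hM, mul_assoc, hJ, mul_one]
  have hGx : Commute (realDiagonal x) G := by
    have h1 : G * realDiagonal x = Wᴴ * (realDiagonal s * M) * W := by
      rw [hG, mul_assoc, ← hW]
      noncomm_ring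
    have h2 : realDiagonal x * G = Wᴴ * (Mᴴ * realDiagonal s) * W := by
      rw [hG, ← mul_assoc Wᴴ, ← conjTranspose_mul, hW, conjTranspose_mul,
        realDiagonal_conjTranspose]
      noncomm_ring
    rw [Commute, SemiconjBy, h1, h2, hJM]
  have hGoff (i j : ι) (hij : i ≠ j) : G i j = 0 := by
    have h := commute_realDiagonal_iff.1 hGx i j
    have hne : (x i : ℂ) - x j ≠ 0 :=
      sub_ne_zero.2 fun h => hij (hx (Complex.ofReal_injective h))
    have : ((x i : ℂ) - x j) * G i j = 0 := by rw [sub_mul, h]; ring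
    exact (mul_eq_zero.1 this).resolve_left hne
  let d : ι → ℝ := fun i => (G i i).re
  have hGd : G = realDiagonal d := by
    ext i j
    by_cases hij : i = j
    · subst hij
      have : star (G i i) = G i i := congrFun (congrFun hGh i) i
      simpa [realDiagonal, d] using (Complex.conj_eq_iff_re.1 this).symm
    · simp [realDiagonal, hij, hGoff i j hij]
  have hdx (i : ι) : 0 < d i * (x i - c) := by
    have h := hpos.dotProduct_mulVec_pos (hv0 i)
    have h1 : star (v i) ⬝ᵥ (realDiagonal s *ᵥ v i) = d i := by
      have : G i i = star (v i) ⬝ᵥ (realDiagonal s *ᵥ v i) := by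
        rw [hG, mul_assoc, mul_apply]
        rfl
      rw [← this, hGd]
      simp [realDiagonal]
    rw [sub_mulVec, ← mulVec_mulVec, hv, mulVec_smul, smul_mulVec, ← sub_smul, dotProduct_smul,
      h1, smul_eq_mul, ← Complex.ofReal_sub, ← Complex.ofReal_mul] at h
    rw [mul_comm]
    exact_mod_cast h
  have hd0 (i : ι) : d i ≠ 0 := fun h => by simpa [h] using hdx i
  have hWu : IsUnit W := by
    rw [isUnit_iff_isUnit_det, isUnit_iff_ne_zero]
    intro h
    have h1 : G.det = 0 := by rw [hG, det_mul, h, mul_zero]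
    rw [hGd, realDiagonal, det_diagonal] at h1
    obtain ⟨i, -, hi⟩ := Finset.prod_eq_zero_iff.1 h1
    exact hd0 i (Complex.ofReal_eq_zero.1 hi)
  have hcard : Fintype.card {i // 0 < d i} = Fintype.card {i // 0 < s i} := by
    refine le_antisymm (card_pos_le_of_congruence hGd) (card_pos_le_of_congruence (V := W⁻¹) ?_)
    have hi : W * W⁻¹ = 1 := mul_nonsing_inv _ ((isUnit_iff_isUnit_det _).1 hWu)
    have hi' : (W⁻¹)ᴴ * Wᴴ = 1 := by rw [← conjTranspose_mul, hi, conjTranspose_one]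
    rw [← hGd, hG]
    calc (W⁻¹)ᴴ * (Wᴴ * realDiagonal s * W) * W⁻¹
        = ((W⁻¹)ᴴ * Wᴴ) * realDiagonal s * (W * W⁻¹) := by noncomm_ring
      _ = realDiagonal s := by rw [hi, hi', one_mul, mul_one]
  have hdpos (i : ι) : 0 < d i ↔ c < x i := by
    refine ⟨fun h => ?_, fun h => ?_⟩
    · exact sub_pos.1 ((pos_iff_pos_of_mul_pos (hdx i)).1 h)
    · exact (pos_iff_pos_of_mul_pos (hdx i)).2 (sub_pos.2 h)
  have hspos (i : ι) : 0 < s i ↔ s i = 1 := by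
    rcases hs i with h | h <;> norm_num [h]
  have hsneg (i : ι) (h : ¬ 0 < s i) : s i = -1 :=
    (hs i).resolve_left fun h' => h ((hspos i).2 h')
  have hds (i : ι) : 0 < d i ↔ 0 < s i := by
    simp only [Fintype.card_subtype] at hcard
    have hsub : (Finset.univ.filter fun i => 0 < d i) ⊆ (Finset.univ.filter fun i => 0 < s i) ∨
        (Finset.univ.filter fun i => 0 < s i) ⊆ (Finset.univ.filter fun i => 0 < d i) := by
      by_contra hcon
      push Not at hcon
      obtain ⟨⟨j, hj, hj'⟩, ⟨k, hk, hk'⟩⟩ :=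
        And.intro (Finset.not_subset.1 hcon.1) (Finset.not_subset.1 hcon.2)
      simp only [Finset.mem_filter, Finset.mem_univ, true_and] at hj hj' hk hk'
      have := hord k j ((hspos k).1 hk) (hsneg j hj')
      exact hk' ((hdpos k).2 (((hdpos j).1 hj).trans this))
    have heq : (Finset.univ.filter fun i => 0 < d i) = Finset.univ.filter fun i => 0 < s i := by
      rcases hsub with h | h
      · exact Finset.eq_of_subset_of_card_le h hcard.ge
      · exact (Finset.eq_of_subset_of_card_le h hcard.le).symm
    simpa using congrArg (i ∈ ·) heq
  let r : ι → ℝ := fun i => (√|d i|)⁻¹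
  refine ⟨W * realDiagonal r, ?_, ?_⟩
  · rw [conjTranspose_mul, realDiagonal_conjTranspose]
    calc realDiagonal r * Wᴴ * realDiagonal s * (W * realDiagonal r)
        = realDiagonal r * G * realDiagonal r := by rw [hG]; noncomm_ring
      _ = realDiagonal s := by
        rw [hGd]
        simp only [realDiagonal, diagonal_mul_diagonal]
        congr 1
        ext i
        rw [← Complex.ofReal_mul, ← Complex.ofReal_mul]
        congr 1
        have h1 : √|d i| * √|d i| = |d i| := Real.mul_self_sqrt (abs_nonneg _)
        have h2 : r i * d i * r i = d i / |d i| := by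
          rw [← h1]
          simp only [r]
          field_simp
        rw [h2, div_eq_iff (abs_ne_zero.2 (hd0 i))]
        by_cases hi : 0 < d i
        · rw [(hspos i).1 ((hds i).1 hi), abs_of_pos hi, one_mul]
        · rw [hsneg i (fun h => hi ((hds i).2 h)), abs_of_nonpos (not_lt.1 hi)]
          ring
  · rw [← mul_assoc, hW, mul_assoc, mul_assoc, (realDiagonal_commute x r).eq]

/-- A sum of two pseudo-unitary conjugates of diagonal matrices with distinct, correctly ordered
eigenvalues `x` can be simultaneously conjugated so that the sum becomes `realDiagonal x`. -/
theorem exists_pseudoUnitary_conj_add_conj_eq {s : ι → ℝ} (hs : ∀ i, s i = 1 ∨ s i = -1)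
    {g h : Matrix ι ι ℂ} (hg : gᴴ * realDiagonal s * g = realDiagonal s)
    (hh : hᴴ * realDiagonal s * h = realDiagonal s) {a b x : ι → ℝ} {c d : ℝ}
    (hc : ∀ i, 0 < s i * (a i - c)) (hd : ∀ i, 0 < s i * (b i - d)) (hx : Function.Injective x)
    (hord : ∀ i j, s i = 1 → s j = -1 → x j < x i)
    (hchar : (g * realDiagonal a * g⁻¹ + h * realDiagonal b * h⁻¹).charpoly =
      ∏ i, (X - C (x i : ℂ))) :
    ∃ g' h' : Matrix ι ι ℂ, g'ᴴ * realDiagonal s * g' = realDiagonal s ∧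
      h'ᴴ * realDiagonal s * h' = realDiagonal s ∧
      g' * realDiagonal a * g'⁻¹ + h' * realDiagonal b * h'⁻¹ = realDiagonal x := by
  have hJ := realDiagonal_mul_self hs
  have hpos : (realDiagonal s * (g * realDiagonal a * g⁻¹ + h * realDiagonal b * h⁻¹) -
      ((c + d : ℝ) : ℂ) • realDiagonal s).PosDef := by
    have := (posDef_conj_realDiagonal hs hg hc).add (posDef_conj_realDiagonal hs hh hd)
    convert this using 1
    rw [mul_add, Complex.ofReal_add, add_smul]
    abel
  obtain ⟨V, hV, hMV⟩ := exists_pseudoUnitary_diagonalization hs (by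
    rw [conjTranspose_add, conj_realDiagonal_conjTranspose hs hg,
      conj_realDiagonal_conjTranspose hs hh, mul_add, add_mul]) hpos hx hord hchar
  have hV' := pseudoUnitary_inv hJ hV
  obtain ⟨hi1, hi2⟩ := pseudoUnitary_mul_inv hJ hV
  refine ⟨V⁻¹ * g, V⁻¹ * h, pseudoUnitary_mul hV' hg, pseudoUnitary_mul hV' hh, ?_⟩
  rw [Matrix.mul_inv_rev, Matrix.mul_inv_rev, inv_eq_left_inv hi2]
  calc _ = V⁻¹ * ((g * realDiagonal a * g⁻¹ + h * realDiagonal b * h⁻¹) * V) := by noncomm_ring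
    _ = realDiagonal x := by rw [hMV, ← mul_assoc, hi1, one_mul]

/-- Two families with the same multiset of values differ by a permutation. -/
theorem exists_perm_of_prod_X_sub_C_eq {κ : Type*} [Fintype κ] {α β : κ → ℂ}
    (h : ∏ i, (X - C (α i)) = ∏ i, (X - C (β i))) :
    ∃ σ : Equiv.Perm κ, ∀ i, α i = β (σ i) := by
  have hm : Finset.univ.val.map α = Finset.univ.val.map β := by
    have key (γ : κ → ℂ) : (∏ i, (X - C (γ i))).roots = Finset.univ.val.map γ := by
      have := roots_multiset_prod_X_sub_C (Finset.univ.val.map γ)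
      rwa [Multiset.map_map] at this
    rw [← key, ← key, h]
  have hcard (z : ℂ) : Fintype.card {i // α i = z} = Fintype.card {i // β i = z} := by
    have := congrArg (Multiset.count z) hm
    rw [Multiset.count_map, Multiset.count_map] at this
    rw [Fintype.card_subtype, Fintype.card_subtype]
    simpa [Finset.card_def, Finset.filter_val, eq_comm] using this
  let e : Equiv.Perm κ := (Equiv.sigmaFiberEquiv α).symm.trans
    ((Equiv.sigmaCongrRight fun z => Fintype.equivOfCardEq (hcard z)).trans
      (Equiv.sigmaFiberEquiv β))
  exact ⟨e, fun i => (Fintype.equivOfCardEq (hcard (α i)) ⟨i, rfl⟩).2.symm⟩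

/-- A diagonal matrix that is a pseudo-unitary conjugate of `realDiagonal a` is obtained from it by
a permutation preserving the blocks. -/
theorem exists_block_perm_of_conj_eq_diagonal {s : ι → ℝ} (hs : ∀ i, s i = 1 ∨ s i = -1)
    {g : Matrix ι ι ℂ} (hg : gᴴ * realDiagonal s * g = realDiagonal s) {a : ι → ℝ} {c : ℝ}
    (hc : ∀ i, 0 < s i * (a i - c))
    (hdiag : ∀ i j, i ≠ j → (g * realDiagonal a * g⁻¹) i j = 0) :
    ∃ σ : Equiv.Perm ι, (∀ i, s (σ i) = s i) ∧
      g * realDiagonal a * g⁻¹ = realDiagonal (a ∘ σ) := by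
  have hJ := realDiagonal_mul_self hs
  set A := g * realDiagonal a * g⁻¹ with hA
  have hAd : A = diagonal fun i => A i i := by
    ext i j
    by_cases hij : i = j
    · subst hij; simp
    · simp [hij, hdiag i j hij]
  have hchar : ∏ i, (X - C (A i i)) = ∏ i, (X - C (a i : ℂ)) := by
    rw [← charpoly_diagonal, ← hAd, hA, Matrix.charpoly_mul_comm, ← mul_assoc,
      (pseudoUnitary_mul_inv hJ hg).1, one_mul, realDiagonal, charpoly_diagonal]
  obtain ⟨σ, hσ⟩ := exists_perm_of_prod_X_sub_C_eq hchar
  have hAσ : A = realDiagonal (a ∘ σ) := by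
    rw [hAd, realDiagonal]
    congr 1
    ext i
    exact hσ i
  refine ⟨σ, fun i => ?_, hAσ⟩
  have hp := posDef_conj_realDiagonal hs hg hc
  rw [← hA, hAσ] at hp
  have hd : realDiagonal s * realDiagonal (a ∘ σ) - (c : ℂ) • realDiagonal s =
      diagonal fun i => ((s i * (a (σ i) - c) : ℝ) : ℂ) := by
    ext i j
    by_cases hij : i = j
    · subst hij
      simp [realDiagonal]
      ring
    · simp [realDiagonal, hij]
  rw [hd, posDef_diagonal_iff] at hp
  have h1 : 0 < s i * (a (σ i) - c) := by exact_mod_cast hp i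
  have h2 := hc (σ i)
  rcases hs i with h | h <;> rcases hs (σ i) with h' | h' <;> rw [h, h'] <;>
    rw [h] at h1 <;> rw [h'] at h2 <;> linarith

/-- Rescaling by a phase makes the determinant of a pseudo-unitary matrix equal to `1`. -/
theorem exists_smul_det_eq_one [Nonempty ι] {s : ι → ℝ} (hs : ∀ i, s i = 1 ∨ s i = -1)
    {g : Matrix ι ι ℂ} (hg : gᴴ * realDiagonal s * g = realDiagonal s) :
    ∃ g' : Matrix ι ι ℂ, g'.det = 1 ∧ g'ᴴ * realDiagonal s * g' = realDiagonal s ∧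
      ∀ A, g' * A * g'⁻¹ = g * A * g⁻¹ := by
  have hJ := realDiagonal_mul_self hs
  have hJd : (realDiagonal s).det ≠ 0 := fun h => by
    simpa [h] using congrArg det hJ
  have hgn : ‖g.det‖ = 1 := by
    have h := congrArg det hg
    rw [det_mul, det_mul, mul_right_comm, det_conjTranspose, Complex.star_def, Complex.conj_mul',
      mul_eq_right₀ hJd] at h
    exact (pow_eq_one_iff_of_nonneg (norm_nonneg _) two_ne_zero).1 (by exact_mod_cast h)
  have hg0 : g.det ≠ 0 := fun h => by simp [h] at hgn
  obtain ⟨z, hz⟩ := IsAlgClosed.exists_pow_nat_eq (g.det)⁻¹ (Fintype.card_pos (α := ι))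
  have hzn : ‖z‖ = 1 := by
    have h := congrArg norm hz
    rw [norm_pow, norm_inv, hgn, inv_one] at h
    exact (pow_eq_one_iff_of_nonneg (norm_nonneg z) Fintype.card_ne_zero).1 h
  have hzz : star z * z = 1 := by rw [Complex.star_def, Complex.conj_mul', hzn]; norm_num
  have hgz : (z • g)ᴴ * realDiagonal s * (z • g) = realDiagonal s := by
    rw [conjTranspose_smul, smul_mul_assoc, smul_mul_assoc, mul_smul_comm, smul_smul, hzz,
      one_smul, hg]
  refine ⟨z • g, ?_, hgz, fun A => ?_⟩
  · rw [det_smul, hz, inv_mul_cancel₀ hg0]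
  · rw [(pseudoUnitary_inv_eq hJ hgz).2, (pseudoUnitary_inv_eq hJ hg).2, conjTranspose_smul,
      mul_smul_comm, smul_mul_assoc, smul_mul_assoc, smul_mul_assoc, mul_smul_comm, smul_smul,
      mul_comm z, hzz, one_smul]

theorem exists_shift_of_lt {κ : Type*} [Fintype κ] {s : κ → ℝ} (hs : ∀ i, s i = 1 ∨ s i = -1)
    {a : κ → ℝ}
    (ha : ∀ i j, s i = 1 → s j = -1 → a j < a i) : ∃ c, ∀ i, 0 < s i * (a i - c) := by
  obtain ⟨c, hlo, hhi⟩ := Order.exists_between_finsets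
    (lo := (Finset.univ.filter fun i => s i = -1).image a)
    (hi := (Finset.univ.filter fun i => s i = 1).image a)
    (by simpa using fun j hj i hi => ha i j hi hj)
  refine ⟨c, fun i => ?_⟩
  rcases hs i with h | h
  · have := hhi (a i) (Finset.mem_image_of_mem a (by simpa using h))
    rw [h]; linarith
  · have := hlo (a i) (Finset.mem_image_of_mem a (by simpa using h))
    rw [h]; linarith

theorem eventually_add_smul_lt {κ : Type*} [Finite κ] (x D : κ → ℝ) :
    ∀ᶠ t : ℝ in 𝓝 0, ∀ i j, x j < x i → (x + t • D) j < (x + t • D) i := by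
  refine Filter.eventually_all.2 fun i => Filter.eventually_all.2 fun j => ?_
  by_cases h : x j < x i
  · have hc (k : κ) : ContinuousAt (fun t : ℝ => (x + t • D) k) 0 := by
      simp only [Pi.add_apply, Pi.smul_apply, smul_eq_mul]
      fun_prop
    filter_upwards [(hc j).eventually_lt (hc i) (by simpa using h)] with t ht _ using ht
  · exact Filter.Eventually.of_forall fun t h' => absurd h' h

theorem isOrderedSpectrum_realDiagonal {p q : ℕ} {x : Fin (p + q) → ℝ}
    (hchamber : ∀ i j : Fin (p + q), i < j → ((j : ℕ) < p ∨ p ≤ (i : ℕ)) → x j < x i)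
    (hcross : ∀ i j : Fin (p + q), (i : ℕ) < p → p ≤ (j : ℕ) → x j < x i) :
    IsOrderedSpectrum p q (realDiagonal x) x := by
  refine ⟨fun i j hij h => ?_, hcross, charpoly_diagonal _⟩
  rcases hij.lt_or_eq with hlt | rfl
  · exact (hchamber i j hlt h).le
  · exact le_rfl

/-- If `A + B` is diagonal with distinct real entries `x` and `A i j ≠ 0` with `i ≠ j`, then `x` can
be moved slightly in the direction `eᵢ - eⱼ` among the diagonal sums of pseudo-unitary conjugates. -/
theorem eventually_exists_conj_add_conj_eq_of_apply_ne_zero {s : ι → ℝ}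
    (hs : ∀ i, s i = 1 ∨ s i = -1) {A B : Matrix ι ι ℂ}
    (hA : Aᴴ = realDiagonal s * A * realDiagonal s)
    (hB : Bᴴ = realDiagonal s * B * realDiagonal s) {x : ι → ℝ} (hx : Function.Injective x)
    (hAB : A + B = realDiagonal x) {i j : ι} (hij : A i j ≠ 0) :
    ∀ᶠ t : ℝ in 𝓝 0, ∃ g h : Matrix ι ι ℂ, gᴴ * realDiagonal s * g = realDiagonal s ∧
      hᴴ * realDiagonal s * h = realDiagonal s ∧
      g * A * g⁻¹ + h * B * h⁻¹ = realDiagonal (x + t • (Pi.single i 1 - Pi.single j 1)) := by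
  refine eventually_exists_conj_add_conj_eq hs hA hB hx hAB fun θ hθ => ?_
  have h := commute_realDiagonal_iff.1 hθ i j
  rw [mul_comm] at h
  have h' : θ i = θ j := Complex.ofReal_injective (mul_left_cancel₀ hij h)
  simp [mul_sub, Finset.sum_sub_distrib, Pi.single_apply, h']

/-- The diagonal of `Jmat`: `1` on the first `p` indices and `-1` on the others. -/
def blockSign (p : ℕ) {n : ℕ} (i : Fin n) : ℝ := if (i : ℕ) < p then 1 else -1

theorem blockSign_eq_or (p : ℕ) {n : ℕ} (i : Fin n) : blockSign p i = 1 ∨ blockSign p i = -1 :=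
  ite_eq_or_eq ..

theorem blockSign_eq_one_iff {p n : ℕ} {i : Fin n} : blockSign p i = 1 ↔ (i : ℕ) < p := by
  unfold blockSign
  split_ifs with h <;> norm_num [h]

theorem blockSign_eq_neg_one_iff {p n : ℕ} {i : Fin n} : blockSign p i = -1 ↔ p ≤ (i : ℕ) := by
  unfold blockSign
  split_ifs with h
  · norm_num [h]
  · simpa using h

theorem Jmat_eq_realDiagonal (p q : ℕ) : Jmat p q = realDiagonal (blockSign p) := by
  rw [Jmat, realDiagonal]
  congr 1
  ext i
  unfold blockSign
  split_ifs <;> simp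

/-- At an extreme point in the open chamber, the summands are diagonal as soon as the sum is. -/
theorem apply_eq_zero_of_mem_extremePoints {p q : ℕ} {a b x : Fin (p + q) → ℝ}
    (hx : x ∈ Set.extremePoints ℝ { x : Fin (p + q) → ℝ |
      ∃ g ∈ SUpq p q, ∃ h ∈ SUpq p q,
        IsOrderedSpectrum p q
          (g * realDiagonal a * g⁻¹ + h * realDiagonal b * h⁻¹) x })
    (hchamber : ∀ i j : Fin (p + q), i < j → ((j : ℕ) < p ∨ p ≤ (i : ℕ)) → x j < x i)
    (hcross : ∀ i j : Fin (p + q), (i : ℕ) < p → p ≤ (j : ℕ) → x j < x i)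
    (hinj : Function.Injective x) {g h : Matrix (Fin (p + q)) (Fin (p + q)) ℂ}
    (hg : gᴴ * realDiagonal (blockSign p) * g = realDiagonal (blockSign p))
    (hh : hᴴ * realDiagonal (blockSign p) * h = realDiagonal (blockSign p))
    (hsum : g * realDiagonal a * g⁻¹ + h * realDiagonal b * h⁻¹ = realDiagonal x)
    {i j : Fin (p + q)} (hij : i ≠ j) : (g * realDiagonal a * g⁻¹) i j = 0 := by
  by_contra hne
  have : Nonempty (Fin (p + q)) := ⟨i⟩
  have hs := blockSign_eq_or p (n := p + q)
  set D : Fin (p + q) → ℝ := Pi.single i 1 - Pi.single j 1 with hD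
  have hev : ∀ᶠ t : ℝ in 𝓝 0, x + t • D ∈ { x : Fin (p + q) → ℝ |
      ∃ g ∈ SUpq p q, ∃ h ∈ SUpq p q,
        IsOrderedSpectrum p q
          (g * realDiagonal a * g⁻¹ + h * realDiagonal b * h⁻¹) x } := by
    filter_upwards [eventually_exists_conj_add_conj_eq_of_apply_ne_zero hs
      (conj_realDiagonal_conjTranspose hs hg a) (conj_realDiagonal_conjTranspose hs hh b) hinj hsum
      hne, eventually_add_smul_lt x D] with t ht hlt
    obtain ⟨u, v, hu, hv, huv⟩ := ht
    obtain ⟨u', hu1, hu2, hu3⟩ := exists_smul_det_eq_one hs (pseudoUnitary_mul hu hg)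
    obtain ⟨v', hv1, hv2, hv3⟩ := exists_smul_det_eq_one hs (pseudoUnitary_mul hv hh)
    refine ⟨u', ⟨hu1, by rwa [Jmat_eq_realDiagonal]⟩, v', ⟨hv1, by rwa [Jmat_eq_realDiagonal]⟩, ?_⟩
    have heq : u' * realDiagonal a * u'⁻¹ + v' * realDiagonal b * v'⁻¹ =
        realDiagonal (x + t • D) := by
      rw [hu3, hv3, Matrix.mul_inv_rev, Matrix.mul_inv_rev, ← huv]
      noncomm_ring
    rw [heq]
    exact isOrderedSpectrum_realDiagonal (fun k l hkl h => hlt k l (hchamber k l hkl h))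
      fun k l hk hl => hlt k l (hcross k l hk hl)
  have hev' := (continuous_neg.tendsto' (0 : ℝ) 0 neg_zero).eventually hev
  obtain ⟨t, ⟨h1, h2⟩, ht⟩ := (((hev.and hev').filter_mono nhdsWithin_le_nhds).and
    (self_mem_nhdsWithin : Set.Ioi (0 : ℝ) ∈ 𝓝[>] 0)).exists
  have hseg : x ∈ openSegment ℝ (x + t • D) (x + (-t) • D) := by
    refine ⟨1 / 2, 1 / 2, by norm_num, by norm_num, by norm_num, ?_⟩
    ext k
    simp
    ring
  have h3 := congrFun (hx.2 h1 h2 hseg) i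
  simp [hD, hij, (ne_of_gt ht : t ≠ 0)] at h3

end

/-- every extreme point of `S` lying in the open chamber
`{x : x₁ > … > x_p, x_{p+1} > … > x_n}` has the form `s(Λ_A^σ + Λ_B^τ)` for block
permutations `σ, τ` (permuting the first `p` indices among themselves and the last `q`
among themselves). -/
theorem extremePoint_in_open_chamber (p q : ℕ) (hp : 1 ≤ p) (hq : 1 ≤ q)
    (a b : Fin (p + q) → ℝ)
    (ha0 : ∑ i, a i = 0) (hb0 : ∑ i, b i = 0)
    (ha : ∀ i j : Fin (p + q), (i : ℕ) < p → p ≤ (j : ℕ) → a j < a i)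
    (hb : ∀ i j : Fin (p + q), (i : ℕ) < p → p ≤ (j : ℕ) → b j < b i)
    (x : Fin (p + q) → ℝ)
    (hx : x ∈ Set.extremePoints ℝ { x : Fin (p + q) → ℝ |
      ∃ g ∈ SUpq p q, ∃ h ∈ SUpq p q,
        IsOrderedSpectrum p q
          (g * Matrix.diagonal (fun i => (a i : ℂ)) * g⁻¹ +
            h * Matrix.diagonal (fun i => (b i : ℂ)) * h⁻¹) x })
    (hchamber : ∀ i j : Fin (p + q), i < j → ((j : ℕ) < p ∨ p ≤ (i : ℕ)) → x j < x i) :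
    ∃ σ τ : Equiv.Perm (Fin (p + q)),
      (∀ i : Fin (p + q), (σ i : ℕ) < p ↔ (i : ℕ) < p) ∧
      (∀ i : Fin (p + q), (τ i : ℕ) < p ↔ (i : ℕ) < p) ∧
      IsOrderedSpectrum p q
        (Matrix.diagonal (fun i => (a (σ i) : ℂ)) +
          Matrix.diagonal (fun i => (b (τ i) : ℂ))) x := by
  have hs := blockSign_eq_or p (n := p + q)
  obtain ⟨g, hgS, h, hhS, hord⟩ := hx.1
  have hcross := hord.2.1
  have hg := hgS.2
  have hh := hhS.2
  rw [Jmat_eq_realDiagonal] at hg hh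
  have hsc {y : Fin (p + q) → ℝ}
      (hy : ∀ i j : Fin (p + q), (i : ℕ) < p → p ≤ (j : ℕ) → y j < y i) (i j : Fin (p + q))
      (hi : blockSign p i = 1) (hj : blockSign p j = -1) : y j < y i :=
    hy i j (blockSign_eq_one_iff.1 hi) (blockSign_eq_neg_one_iff.1 hj)
  have hinj : Function.Injective x := by
    refine .of_lt_imp_ne fun i j hij => ?_
    by_cases hij' : (j : ℕ) < p ∨ p ≤ (i : ℕ)
    · exact (hchamber i j hij hij').ne'
    · push Not at hij'
      exact (hcross i j hij'.2 hij'.1).ne'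
  obtain ⟨c, hc⟩ := exists_shift_of_lt hs (hsc ha)
  obtain ⟨d, hd⟩ := exists_shift_of_lt hs (hsc hb)
  obtain ⟨g', h', hg', hh', hsum⟩ :=
    exists_pseudoUnitary_conj_add_conj_eq hs hg hh hc hd hinj (hsc hcross) hord.2.2
  have hoff (i j : Fin (p + q)) (hij : i ≠ j) :
      (g' * realDiagonal a * g'⁻¹) i j = 0 :=
    apply_eq_zero_of_mem_extremePoints hx hchamber hcross hinj hg' hh' hsum hij
  have hoff' (i j : Fin (p + q)) (hij : i ≠ j) :
      (h' * realDiagonal b * h'⁻¹) i j = 0 := by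
    have := congrFun (congrFun hsum i) j
    rw [Matrix.add_apply, hoff i j hij, zero_add] at this
    rw [this, realDiagonal, diagonal_apply_ne _ hij]
  obtain ⟨σ, hσ, hAσ⟩ := exists_block_perm_of_conj_eq_diagonal hs hg' hc hoff
  obtain ⟨τ, hτ, hBτ⟩ := exists_block_perm_of_conj_eq_diagonal hs hh' hd hoff'
  have hblock {ρ : Equiv.Perm (Fin (p + q))} (hρ : ∀ i, blockSign p (ρ i) = blockSign p i)
      (i : Fin (p + q)) : (ρ i : ℕ) < p ↔ (i : ℕ) < p := by
    rw [← blockSign_eq_one_iff, hρ, blockSign_eq_one_iff]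
  refine ⟨σ, τ, hblock hσ, hblock hτ, ?_⟩
  rw [hAσ, hBτ] at hsum
  have := isOrderedSpectrum_realDiagonal hchamber hcross
  rwa [← hsum] at this
end
end

section
/- Let Λ = diag(d₁,…,d_n) be a traceless real diagonal matrix with dᵢ > d_{p+j} for all 1 ≤ i ≤ p and 1 ≤ j ≤ q, and let O = { gΛg⁻¹ : g ∈ SU(p,q) } with the subspace topology from the space of complex n×n matrices. Then the map O → ℝⁿ sending A to its (real) diagonal vector (A₁₁,…,A_nn) is proper: the preimage of every compact subset of ℝⁿ is compact. -/
open Matrix Polynomial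

noncomputable section

/-- The diagonal entries of `J`. -/
def signatureSign (p q : ℕ) (i : Fin (p + q)) : ℝ := if (i : ℕ) < p then 1 else -1

lemma Jmat_eq_diagonal_signatureSign (p q : ℕ) :
    Jmat p q = Matrix.diagonal fun i => (signatureSign p q i : ℂ) := by
  unfold Jmat signatureSign
  congr 1
  funext i
  split_ifs <;> simp

lemma signatureSign_mul_self (p q : ℕ) (i : Fin (p + q)) :
    signatureSign p q i * signatureSign p q i = 1 := by
  unfold signatureSign
  split_ifs <;> norm_num

lemma abs_signatureSign (p q : ℕ) (i : Fin (p + q)) : |signatureSign p q i| = 1 := by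
  unfold signatureSign
  split_ifs <;> norm_num

lemma Jmat_mul_self (p q : ℕ) : Jmat p q * Jmat p q = 1 := by
  rw [Jmat_eq_diagonal_signatureSign, Matrix.diagonal_mul_diagonal, ← Matrix.diagonal_one]
  congr 1
  funext i
  exact_mod_cast signatureSign_mul_self p q i

lemma conjTranspose_mul_self_of_mem_SUpq {p q : ℕ} {g : Matrix (Fin (p + q)) (Fin (p + q)) ℂ}
    (hg : g ∈ SUpq p q) : Jmat p q * gᴴ * Jmat p q * g = 1 := by
  rw [Matrix.mul_assoc, Matrix.mul_assoc, ← Matrix.mul_assoc gᴴ, hg.2, Jmat_mul_self]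

lemma inv_eq_of_mem_SUpq {p q : ℕ} {g : Matrix (Fin (p + q)) (Fin (p + q)) ℂ}
    (hg : g ∈ SUpq p q) : g⁻¹ = Jmat p q * gᴴ * Jmat p q :=
  Matrix.inv_eq_left_inv (conjTranspose_mul_self_of_mem_SUpq hg)

lemma isClosed_SUpq (p q : ℕ) : IsClosed (SUpq p q) :=
  (isClosed_eq (by fun_prop) (by fun_prop)).inter (isClosed_eq (by fun_prop) (by fun_prop))

/-- The diagonal entries of `g * diagonal d * (J * gᴴ * J)`. -/
lemma conj_diagonal_apply_self (p q : ℕ) (d : Fin (p + q) → ℝ)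
    (g : Matrix (Fin (p + q)) (Fin (p + q)) ℂ) (k : Fin (p + q)) :
    ((g * Matrix.diagonal (fun i => (d i : ℂ)) * (Jmat p q * gᴴ * Jmat p q)) k k).re =
      signatureSign p q k * ∑ i, d i * signatureSign p q i * ‖g k i‖ ^ 2 := by
  rw [Jmat_eq_diagonal_signatureSign, Matrix.mul_apply, Complex.re_sum, Finset.mul_sum]
  refine Finset.sum_congr rfl fun i _ => ?_
  rw [Matrix.mul_diagonal, Matrix.mul_diagonal, Matrix.diagonal_mul, Matrix.conjTranspose_apply]
  have h : g k i * star (g k i) = ((‖g k i‖ ^ 2 : ℝ) : ℂ) := by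
    simpa using Complex.mul_conj' (g k i)
  have h' : g k i * (d i : ℂ) * ((signatureSign p q i : ℂ) * star (g k i) *
      (signatureSign p q k : ℂ)) =
      ((signatureSign p q k * (d i * signatureSign p q i * ‖g k i‖ ^ 2) : ℝ) : ℂ) := by
    calc _ = (signatureSign p q k : ℂ) * (d i * signatureSign p q i * (g k i * star (g k i))) := by
          ring
      _ = _ := by rw [h]; push_cast; ring
  rw [h', Complex.ofReal_re]

/-- A real number `c` separating the two blocks of `d` turns the entries of `g ∈ SU(p,q)` into
the terms of a nonnegative sum determined by the diagonal of `g * diagonal d * g⁻¹`. -/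
lemma sum_abs_sub_mul_norm_sq_of_mem_SUpq {p q : ℕ} {d : Fin (p + q) → ℝ} {c : ℝ}
    (hc : ∀ i, (d i - c) * signatureSign p q i = |d i - c|)
    {g : Matrix (Fin (p + q)) (Fin (p + q)) ℂ} (hg : g ∈ SUpq p q) (k : Fin (p + q)) :
    ∑ i, |d i - c| * ‖g k i‖ ^ 2 = signatureSign p q k *
      (((g * Matrix.diagonal (fun i => (d i : ℂ)) * (Jmat p q * gᴴ * Jmat p q)) k k).re - c) := by
  have hone := conj_diagonal_apply_self p q 1 g k
  have hinv := mul_eq_one_comm.mp (conjTranspose_mul_self_of_mem_SUpq hg)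
  simp only [Pi.one_apply, Complex.ofReal_one, Matrix.diagonal_one, Matrix.mul_one, hinv,
    Matrix.one_apply_eq, Complex.one_re, one_mul] at hone
  rw [conj_diagonal_apply_self]
  have hs := signatureSign_mul_self p q k
  have hsplit : ∑ i, |d i - c| * ‖g k i‖ ^ 2 = ∑ i, d i * signatureSign p q i * ‖g k i‖ ^ 2 -
      c * ∑ i, signatureSign p q i * ‖g k i‖ ^ 2 := by
    rw [Finset.mul_sum, ← Finset.sum_sub_distrib]
    refine Finset.sum_congr rfl fun i _ => ?_
    rw [← hc]
    ring
  rw [hsplit]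
  linear_combination (signatureSign p q k * c) * hone -
    (∑ i, d i * signatureSign p q i * ‖g k i‖ ^ 2 -
      c * ∑ i, signatureSign p q i * ‖g k i‖ ^ 2) * hs

lemma exists_separating_real {p q : ℕ} {d : Fin (p + q) → ℝ}
    (hd : ∀ i j : Fin (p + q), (i : ℕ) < p → p ≤ (j : ℕ) → d j < d i) :
    ∃ c, ∀ i, d i ≠ c ∧ (d i - c) * signatureSign p q i = |d i - c| := by
  classical
  obtain ⟨c, hlo, hhi⟩ := Order.exists_between_finsets
    (lo := (Finset.univ.filter fun j : Fin (p + q) => p ≤ (j : ℕ)).image d)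
    (hi := (Finset.univ.filter fun i : Fin (p + q) => (i : ℕ) < p).image d)
    (by simpa using fun j hj i hi => hd i j hi hj)
  refine ⟨c, fun i => ?_⟩
  unfold signatureSign
  split_ifs with h
  · have : c < d i := hhi _ (by simpa using ⟨i, h, rfl⟩)
    exact ⟨this.ne', by rw [abs_of_pos (sub_pos.2 this), mul_one]⟩
  · have : d i < c := hlo _ (by simpa using ⟨i, not_lt.1 h, rfl⟩)
    exact ⟨this.ne, by rw [abs_of_neg (sub_neg.2 this), mul_neg_one]⟩

lemma continuous_conj_diagonal (p q : ℕ) (d : Fin (p + q) → ℝ) :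
    Continuous fun g : Matrix (Fin (p + q)) (Fin (p + q)) ℂ =>
      g * Matrix.diagonal (fun i => (d i : ℂ)) * (Jmat p q * gᴴ * Jmat p q) :=
  (continuous_id.matrix_mul continuous_const).matrix_mul
    ((continuous_const.matrix_mul continuous_id.matrix_conjTranspose).matrix_mul continuous_const)

/-- The elements of `SU(p,q)` conjugating `diagonal d` to a matrix with diagonal in a compact set
form a compact set. -/
lemma isCompact_SUpq_diagonal_mem {p q : ℕ} {d : Fin (p + q) → ℝ}
    (hd : ∀ i j : Fin (p + q), (i : ℕ) < p → p ≤ (j : ℕ) → d j < d i)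
    {K : Set (Fin (p + q) → ℝ)} (hK : IsCompact K) :
    IsCompact (SUpq p q ∩ { g | (fun k => ((g * Matrix.diagonal (fun i => (d i : ℂ)) *
      (Jmat p q * gᴴ * Jmat p q)) k k).re) ∈ K }) := by
  obtain ⟨c, hc⟩ := exists_separating_real hd
  obtain ⟨R, hR⟩ := hK.isBounded.exists_norm_le
  have hbox : IsCompact (Set.univ.pi fun _ : Fin (p + q) => Set.univ.pi fun i : Fin (p + q) =>
      Metric.closedBall (0 : ℂ) (√((R + |c|) / |d i - c|))) :=
    isCompact_univ_pi fun _ => isCompact_univ_pi fun _ => isCompact_closedBall _ _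
  refine hbox.of_isClosed_subset
    ((isClosed_SUpq p q).inter (hK.isClosed.preimage (continuous_pi fun k =>
      Complex.continuous_re.comp ((continuous_conj_diagonal p q d).matrix_elem k k)))) ?_
  rintro g ⟨hg, hgK⟩ k - i -
  rw [mem_closedBall_zero_iff]
  apply Real.le_sqrt_of_sq_le
  rw [le_div_iff₀ (abs_pos.2 (sub_ne_zero.2 (hc i).1)), mul_comm]
  calc |d i - c| * ‖g k i‖ ^ 2 ≤ ∑ i, |d i - c| * ‖g k i‖ ^ 2 :=
        Finset.single_le_sum (f := fun i => |d i - c| * ‖g k i‖ ^ 2)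
          (fun _ _ => by positivity) (Finset.mem_univ i)
    _ = _ := sum_abs_sub_mul_norm_sq_of_mem_SUpq (fun i => (hc i).2) hg k
    _ ≤ _ := le_abs_self _
    _ ≤ R + |c| := by
        rw [abs_mul, abs_signatureSign, one_mul]
        refine (abs_sub _ _).trans (add_le_add_left ?_ _)
        exact (norm_le_pi_norm _ k).trans (hR _ hgK)

/-- on the orbit `O = {g Λ g⁻¹ : g ∈ SU(p,q)}` of an admissible real
diagonal matrix, the map sending a matrix to its (real) diagonal vector is proper:
preimages of compact subsets of `ℝⁿ` are compact. -/
theorem diagonal_map_proper_on_orbit (p q : ℕ) (hp : 1 ≤ p) (hq : 1 ≤ q)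
    (d : Fin (p + q) → ℝ) (hd0 : ∑ i, d i = 0)
    (hd : ∀ i j : Fin (p + q), (i : ℕ) < p → p ≤ (j : ℕ) → d j < d i)
    (K : Set (Fin (p + q) → ℝ)) (hK : IsCompact K) :
    IsCompact { A : Matrix (Fin (p + q)) (Fin (p + q)) ℂ |
      (∃ g ∈ SUpq p q, A = g * Matrix.diagonal (fun i => (d i : ℂ)) * g⁻¹) ∧
      (fun k => (A k k).re) ∈ K } := by
  convert (isCompact_SUpq_diagonal_mem hd hK).image (continuous_conj_diagonal p q d) using 1
  ext A
  constructor
  · rintro ⟨⟨g, hg, rfl⟩, hA⟩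
    rw [inv_eq_of_mem_SUpq hg] at hA ⊢
    exact ⟨g, ⟨hg, hA⟩, rfl⟩
  · rintro ⟨g, ⟨hg, hA⟩, rfl⟩
    exact ⟨⟨g, hg, by rw [inv_eq_of_mem_SUpq hg]⟩, hA⟩
end
end
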